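/- arXiv:2602.23529 — 8 statements merged into one kernel-verified Lean document; each statement's English description precedes it below -/
import Mathlib

section
/- Let N be a finite ground set, f : 2^N → ℝ a subadditive set function with f(∅) = 0, and let 𝒦 ⊆ ℒ ⊆ 2^N ∖ 𝒦₀. Then the ℓ¹-divergence is monotonically non-increasing in the set of revealed subsets: Δ_f(𝒦) ≥ Δ_f(ℒ). -/
open Finset

/-- The minimal information family: the empty set, the ground set, and all singletons. -/
def K0 (N : Type*) [Fintype N] : Set (Finset N) :=
  {∅, (Finset.univ : Finset N)} ∪ {S : Finset N | ∃ i : N, S = {i}}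

/-- A set function is subadditive if `f (S ∪ T) ≤ f S + f T` for disjoint `S`, `T`. -/
def SubadditiveSF {N : Type*} [DecidableEq N] (f : Finset N → ℝ) : Prop :=
  ∀ S T : Finset N, Disjoint S T → f (S ∪ T) ≤ f S + f T

/-- A set function is monotone if `S ⊆ T` implies `f S ≤ f T`. -/
def MonotoneSF {N : Type*} (f : Finset N → ℝ) : Prop :=
  ∀ S T : Finset N, S ⊆ T → f S ≤ f T

/-- Elementwise monotonicity: `f S ≤ f (S ∪ {i})`. -/
def MonotoneStep {N : Type*} [DecidableEq N] (f : Finset N → ℝ) : Prop :=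
  ∀ (S : Finset N) (i : N), i ∉ S → f S ≤ f (insert i S)

/-- Upper completion: minimum of `∑ f Sᵢ` over families of pairwise disjoint nonempty
sets `Sᵢ ∈ K` partitioning `S`; it is `0` at `∅`. -/
noncomputable def upperC {N : Type*} [DecidableEq N] (f : Finset N → ℝ)
    (K : Set (Finset N)) (S : Finset N) : ℝ :=
  if S = ∅ then 0 else
    sInf {x : ℝ | ∃ P : Finset (Finset N),
      (∀ T ∈ P, T ∈ K) ∧ (∀ T ∈ P, T ≠ ∅) ∧
      (∀ T₁ ∈ P, ∀ T₂ ∈ P, T₁ ≠ T₂ → Disjoint T₁ T₂) ∧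
      P.sup id = S ∧ x = ∑ T ∈ P, f T}

/-- Lower completion: maximum of `f T - upperC f K (T \ S)` over `T ∈ K` with `S ⊆ T`. -/
noncomputable def lowerC {N : Type*} [DecidableEq N] (f : Finset N → ℝ)
    (K : Set (Finset N)) (S : Finset N) : ℝ :=
  sSup {x : ℝ | ∃ T ∈ K, S ⊆ T ∧ x = f T - upperC f K (T \ S)}

/-- The ℓ¹-divergence of `f` with revealed family `K ⊆ 2^N \ K0`. -/
noncomputable def ldiv {N : Type*} [Fintype N] [DecidableEq N] (f : Finset N → ℝ)
    (K : Set (Finset N)) : ℝ :=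
  ∑ T : Finset N, (upperC f (K0 N ∪ K) T - lowerC f (K0 N ∪ K) T)

/-- SAM upper completion: minimum of `∑ f Sᵢ` over nonempty finite families
`S₁, …, S_k ∈ K` covering `S`. -/
noncomputable def samUpper {N : Type*} [DecidableEq N] (f : Finset N → ℝ)
    (K : Set (Finset N)) (S : Finset N) : ℝ :=
  sInf {x : ℝ | ∃ (k : ℕ) (Ss : Fin (k + 1) → Finset N),
    (∀ i, Ss i ∈ K) ∧ S ⊆ Finset.univ.sup Ss ∧ x = ∑ i, f (Ss i)}

/-- SAM lower completion. -/
noncomputable def samLower {N : Type*} [DecidableEq N] (f : Finset N → ℝ)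
    (K : Set (Finset N)) (S : Finset N) : ℝ :=
  max (sSup {x : ℝ | ∃ Y ∈ K, Y ⊆ S ∧ x = f Y})
      (sSup {x : ℝ | ∃ X ∈ K, S ⊆ X ∧ x = f X - samUpper f K (X \ S)})

/-- The SAM ℓ¹-divergence. -/
noncomputable def samDiv {N : Type*} [Fintype N] [DecidableEq N] (f : Finset N → ℝ)
    (K : Set (Finset N)) : ℝ :=
  ∑ T : Finset N, (samUpper f (K0 N ∪ K) T - samLower f (K0 N ∪ K) T)

/-- `{(α i, T i)}` is a fractional cover of `S`. -/
def IsFracCover {N : Type*} [DecidableEq N] (S : Finset N) (k : ℕ)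
    (α : Fin k → ℝ) (T : Fin k → Finset N) : Prop :=
  (∀ i, 0 < α i) ∧
  ∀ j ∈ S, (1 : ℝ) ≤ ∑ i ∈ Finset.univ.filter (fun i => j ∈ T i), α i

/-- A set function is fractionally subadditive. -/
def FracSubadditive {N : Type*} [DecidableEq N] (f : Finset N → ℝ) : Prop :=
  ∀ (S : Finset N) (k : ℕ) (α : Fin k → ℝ) (T : Fin k → Finset N),
    IsFracCover S k α T → f S ≤ ∑ i, α i * f (T i)

/-- XOS: pointwise maximum of finitely many nonnegative additive set functions. -/
def IsXOS {N : Type*} (f : Finset N → ℝ) : Prop :=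
  ∃ (s : ℕ) (a : Fin (s + 1) → N → ℝ),
    (∀ i j, 0 ≤ a i j) ∧
    ∀ S : Finset N, f S = Finset.univ.sup' Finset.univ_nonempty (fun i => ∑ j ∈ S, a i j)

/-- XOS upper completion: infimum of `∑ αᵢ f Tᵢ` over fractional covers of `S`
using sets from `K`. -/
noncomputable def xosUpper {N : Type*} [DecidableEq N] (f : Finset N → ℝ)
    (K : Set (Finset N)) (S : Finset N) : ℝ :=
  sInf {x : ℝ | ∃ (k : ℕ) (α : Fin k → ℝ) (T : Fin k → Finset N),
    IsFracCover S k α T ∧ (∀ i, T i ∈ K) ∧ x = ∑ i, α i * f (T i)}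

/-- On a finite ground set, enlarging a family that contains all singletons can only decrease
the upper completion. -/
theorem upperC_anti {N : Type*} [Finite N] [DecidableEq N] (f : Finset N → ℝ)
    {K L : Set (Finset N)} (hK : ∀ i, {i} ∈ K) (hKL : K ⊆ L) (S : Finset N) :
    upperC f L S ≤ upperC f K S := by
  unfold upperC
  split_ifs with hS
  · exact le_rfl
  apply csInf_le_csInf
  · refine ((Set.finite_range fun P : Finset (Finset N) => ∑ T ∈ P, f T).subset ?_).bddBelow
    rintro x ⟨P, -, -, -, -, rfl⟩
    exact ⟨P, rfl⟩
  · refine ⟨_, S.image fun i => {i}, ?_, ?_, ?_, ?_, rfl⟩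
    · simpa using fun i _ => hK i
    · simp
    · simpa using fun _ _ _ _ h => Ne.symm h
    · ext j
      simp
  · rintro x ⟨P, hP, hrest⟩
    exact ⟨P, fun T hT => hKL (hP T hT), hrest⟩

/-- On a finite ground set, enlarging a family that contains all singletons and the ground set
can only increase the lower completion. -/
theorem lowerC_mono {N : Type*} [Fintype N] [DecidableEq N] (f : Finset N → ℝ)
    {K L : Set (Finset N)} (hK : ∀ i, {i} ∈ K) (hK_univ : Finset.univ ∈ K) (hKL : K ⊆ L)
    (S : Finset N) : lowerC f K S ≤ lowerC f L S := by
  unfold lowerC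
  refine csSup_le ⟨_, Finset.univ, hK_univ, S.subset_univ, rfl⟩ ?_
  rintro x ⟨T, hT, hST, rfl⟩
  refine (sub_le_sub_left (upperC_anti f hK hKL (T \ S)) (f T)).trans
    (le_csSup ?_ ⟨T, hKL hT, hST, rfl⟩)
  refine ((Set.finite_range fun T => f T - upperC f L (T \ S)).subset ?_).bddAbove
  rintro x ⟨U, -, -, rfl⟩
  exact ⟨U, rfl⟩

/-- the ℓ¹-divergence is monotonically non-increasing in the set of
revealed subsets. -/
theorem divergence_antitone {N : Type*} [Fintype N] [DecidableEq N]
    (f : Finset N → ℝ) (hf0 : f ∅ = 0) (hsub : SubadditiveSF f)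
    (K L : Set (Finset N)) (hKL : K ⊆ L) (hL : L ⊆ (K0 N)ᶜ) :
    ldiv f L ≤ ldiv f K := by
  have h_singleton (i : N) : {i} ∈ K0 N ∪ K := Or.inl (Or.inr ⟨i, rfl⟩)
  have h_univ : Finset.univ ∈ K0 N ∪ K := Or.inl (Or.inl (Or.inr rfl))
  have h_subset : K0 N ∪ K ⊆ K0 N ∪ L := Set.union_subset_union_right _ hKL
  exact Finset.sum_le_sum fun T _ => sub_le_sub (upperC_anti f h_singleton h_subset T)
    (lowerC_mono f h_singleton h_univ h_subset T)
end

section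
/- Let N be a finite ground set, 𝒦₀ ⊆ 𝒦 ⊆ 2^N, and let (f, 𝒦) be an incomplete set function with f(∅) = 0. Then for every subadditive extension g of (f, 𝒦) and every S ⊆ N one has f̲_𝒦(S) ≤ g(S) ≤ f̄_𝒦(S). -/
open Finset

/-- A subadditive function vanishing at `∅` is subadditive over finite disjoint families. -/
theorem SubadditiveSF.le_sum {N : Type*} [DecidableEq N] {g : Finset N → ℝ}
    (hg : SubadditiveSF g) (h0 : g ∅ = 0) (P : Finset (Finset N))
    (hP : ∀ T₁ ∈ P, ∀ T₂ ∈ P, T₁ ≠ T₂ → Disjoint T₁ T₂) :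
    g (P.sup id) ≤ ∑ T ∈ P, g T := by
  induction P using Finset.induction_on with
  | empty => simp [h0]
  | insert A P hA ih =>
    rw [Finset.sup_insert, Finset.sum_insert hA]
    have hdisj : Disjoint A (P.sup id) := by
      rw [Finset.disjoint_sup_right]
      intro T hT
      exact hP A (Finset.mem_insert_self A P) T (Finset.mem_insert_of_mem hT)
        (fun h => hA (h ▸ hT))
    have hrest := ih fun T₁ h₁ T₂ h₂ =>
      hP T₁ (Finset.mem_insert_of_mem h₁) T₂ (Finset.mem_insert_of_mem h₂)
    have hunion := hg A (P.sup id) hdisj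
    simp only [id_eq, Finset.sup_eq_union]
    linarith

/-- A subadditive function agreeing with `f` on `K` is at most the upper completion of `f`. -/
theorem SubadditiveSF.le_upperC {N : Type*} [DecidableEq N] {f g : Finset N → ℝ}
    {K : Set (Finset N)} (hg : SubadditiveSF g) (h0 : g ∅ = 0)
    (hsingle : ∀ i : N, {i} ∈ K) (hagree : ∀ S ∈ K, g S = f S) (S : Finset N) :
    g S ≤ upperC f K S := by
  unfold upperC
  split_ifs with hS
  · rw [hS, h0]
  · apply le_csInf
    · refine ⟨_, S.image fun i => {i}, ?_, ?_, ?_, ?_, rfl⟩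
      · simpa using fun i _ => hsingle i
      · simp
      · simp only [Finset.mem_image]
        rintro _ ⟨i, -, rfl⟩ _ ⟨j, -, rfl⟩ hij
        rw [Finset.disjoint_singleton]
        exact fun h => hij (h ▸ rfl)
      · ext x
        simp
    · rintro _ ⟨P, hPK, -, hdisj, rfl, rfl⟩
      rw [← Finset.sum_congr rfl fun T hT => hagree T (hPK T hT)]
      exact hg.le_sum h0 P hdisj

/-- every subadditive extension of `(f, K)` lies between the lower and
upper completions. -/
theorem completions_bound_extensions {N : Type*} [Fintype N] [DecidableEq N]
    (f g : Finset N → ℝ) (K : Set (Finset N))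
    (hK0 : K0 N ⊆ K) (hf0 : f ∅ = 0)
    (hg : SubadditiveSF g) (hagree : ∀ S ∈ K, g S = f S) :
    ∀ S : Finset N, lowerC f K S ≤ g S ∧ g S ≤ upperC f K S := by
  have hempty : (∅ : Finset N) ∈ K := hK0 (by simp [K0])
  have huniv : (Finset.univ : Finset N) ∈ K := hK0 (by simp [K0])
  have hsingle : ∀ i : N, {i} ∈ K := fun i => hK0 (Or.inr ⟨i, rfl⟩)
  have hg0 : g ∅ = 0 := (hagree ∅ hempty).trans hf0
  have hupper := hg.le_upperC hg0 hsingle hagree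
  refine fun S => ⟨csSup_le ⟨_, Finset.univ, huniv, Finset.subset_univ S, rfl⟩ ?_, hupper S⟩
  rintro _ ⟨T, hT, hST, rfl⟩
  have hunion := hg S (T \ S) Finset.disjoint_sdiff
  rw [Finset.union_sdiff_of_subset hST, hagree T hT] at hunion
  linarith [hupper (T \ S)]
end

section
/- Let N be a finite ground set, 𝒦₀ ⊆ 𝒦 ⊆ 2^N, and f : 𝒦 → ℝ with f(∅) = 0. Then the SAM upper completion f̄ˢᵃᵐ_𝒦 is monotone (S ⊆ T implies f̄ˢᵃᵐ_𝒦(S) ≤ f̄ˢᵃᵐ_𝒦(T)) and subadditive (f̄ˢᵃᵐ_𝒦(S ∪ T) ≤ f̄ˢᵃᵐ_𝒦(S) + f̄ˢᵃᵐ_𝒦(T) for all disjoint S, T ⊆ N). -/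
open Finset

/-- The costs of the nonempty finite covers of `S` by members of `K`. -/
def coverCosts {N : Type*} [DecidableEq N] (f : Finset N → ℝ)
    (K : Set (Finset N)) (S : Finset N) : Set ℝ :=
  {x : ℝ | ∃ (k : ℕ) (Ss : Fin (k + 1) → Finset N),
    (∀ i, Ss i ∈ K) ∧ S ⊆ Finset.univ.sup Ss ∧ x = ∑ i, f (Ss i)}

section CoverCosts

variable {N : Type*} [DecidableEq N] {f : Finset N → ℝ} {K : Set (Finset N)} {S T : Finset N}

theorem samUpper_eq_sInf_coverCosts : samUpper f K S = sInf (coverCosts f K S) := rfl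

theorem coverCosts_anti (h : S ⊆ T) : coverCosts f K T ⊆ coverCosts f K S := by
  rintro x ⟨k, Ss, hK, hT, hx⟩
  exact ⟨k, Ss, hK, h.trans hT, hx⟩

theorem mem_coverCosts_of_subset (hT : T ∈ K) (h : S ⊆ T) : f T ∈ coverCosts f K S :=
  ⟨0, fun _ => T, fun _ => hT, by simpa using h, by simp⟩

theorem add_mem_coverCosts_union {x y : ℝ} (hx : x ∈ coverCosts f K S)
    (hy : y ∈ coverCosts f K T) : x + y ∈ coverCosts f K (S ∪ T) := by
  obtain ⟨k, A, hAK, hSA, rfl⟩ := hx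
  obtain ⟨l, B, hBK, hTB, rfl⟩ := hy
  refine ⟨k + 1 + l, Fin.append (n := l + 1) A B, fun i => ?_, fun j hj => ?_, ?_⟩
  · exact Fin.addCases (motive := fun i => Fin.append (n := l + 1) A B i ∈ K)
      (fun i => by simpa using hAK i) (fun i => by simpa using hBK i) i
  · rw [Finset.mem_sup]
    rcases Finset.mem_union.mp hj with hj | hj
    · obtain ⟨i, -, hi⟩ := Finset.mem_sup.mp (hSA hj)
      exact ⟨Fin.castAdd (l + 1) i, Finset.mem_univ _, by rwa [Fin.append_left]⟩
    · obtain ⟨i, -, hi⟩ := Finset.mem_sup.mp (hTB hj)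
      exact ⟨Fin.natAdd (k + 1) i, Finset.mem_univ _, by rwa [Fin.append_right]⟩
  · have h := Fin.sum_univ_add (fun i => f (Fin.append (n := l + 1) A B i))
    simp only [Fin.append_left, Fin.append_right] at h
    exact h.symm

theorem bddBelow_coverCosts (hf : ∀ A ∈ K, 0 ≤ f A) : BddBelow (coverCosts f K S) := by
  refine ⟨0, ?_⟩
  rintro x ⟨k, Ss, hK, -, rfl⟩
  exact Finset.sum_nonneg fun i _ => hf _ (hK i)

theorem not_bddBelow_coverCosts {A : Finset N} (hA : A ∈ K) (hfA : f A < 0) (hT : T ∈ K)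
    (h : S ⊆ T) : ¬ BddBelow (coverCosts f K S) := by
  rintro ⟨m, hm⟩
  have hmem : ∀ n : ℕ, f T + n * f A ∈ coverCosts f K S := by
    intro n
    induction n with
    | zero => simpa using mem_coverCosts_of_subset hT h
    | succ n ih =>
      have := add_mem_coverCosts_union ih (mem_coverCosts_of_subset hA (Finset.empty_subset A))
      rw [Finset.union_empty] at this
      convert this using 1
      push_cast
      ring
  obtain ⟨n, hn⟩ := exists_lt_nsmul (neg_pos.mpr hfA) (f T - m)
  have := hm (hmem n)
  rw [nsmul_eq_mul] at hn
  linarith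

end CoverCosts

/-- the SAM upper completion is monotone and subadditive. -/
theorem samUpper_monotone_subadditive {N : Type*} [Fintype N] [DecidableEq N]
    (f : Finset N → ℝ) (K : Set (Finset N))
    (hK0 : K0 N ⊆ K) (hf0 : f ∅ = 0) :
    (∀ S T : Finset N, S ⊆ T → samUpper f K S ≤ samUpper f K T) ∧
    (∀ S T : Finset N, Disjoint S T →
      samUpper f K (S ∪ T) ≤ samUpper f K S + samUpper f K T) := by
  have huniv : (Finset.univ : Finset N) ∈ K := hK0 (Or.inl (Or.inr rfl))
  have hne : ∀ S : Finset N, (coverCosts f K S).Nonempty := fun S =>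
    ⟨_, mem_coverCosts_of_subset huniv (Finset.subset_univ S)⟩
  by_cases hf : ∀ A ∈ K, 0 ≤ f A
  · simp only [samUpper_eq_sInf_coverCosts]
    refine ⟨fun S T h => csInf_le_csInf (bddBelow_coverCosts hf) (hne T) (coverCosts_anti h),
      fun S T _ => ?_⟩
    rw [← csInf_add (hne S) (bddBelow_coverCosts hf) (hne T) (bddBelow_coverCosts hf)]
    refine csInf_le_csInf (bddBelow_coverCosts hf) ((hne S).add (hne T)) ?_
    rintro _ ⟨x, hx, y, hy, rfl⟩
    exact add_mem_coverCosts_union hx hy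
  · -- The costs are unbounded below, so every infimum takes its default value `0`.
    push Not at hf
    obtain ⟨A, hA, hfA⟩ := hf
    have hzero : ∀ S : Finset N, samUpper f K S = 0 := fun S =>
      Real.sInf_of_not_bddBelow (not_bddBelow_coverCosts hA hfA huniv (Finset.subset_univ S))
    simp [hzero]
end

section
/- Let N be a finite ground set, 𝒦₀ ⊆ 𝒦 ⊆ 2^N, and let (f, 𝒦) with f(∅) = 0 be an incomplete set function. Suppose h : 2^N → ℝ satisfies g(S) ≤ h(S) for every subadditive monotone extension g of (f, 𝒦) and every S ⊆ N. Define h'(S) := min over X ⊆ S of (h(X) + h(S ∖ X)) and h''(S) := min over T ⊆ N with S ⊆ T of h'(T). Then h' and h'' also satisfy g(S) ≤ h'(S) and g(S) ≤ h''(S) for every subadditive monotone extension g of (f, 𝒦) and every S ⊆ N; that is, the subadditivity-refinement and monotonicity-refinement steps of the iterative SAM-upper-bound algorithm preserve the upper-bound property. -/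
open Finset

/-- Subadditivity refinement: `h'(S) := min over X ⊆ S of (h X + h (S \ X))`. -/
noncomputable def refineSub {N : Type*} [DecidableEq N] (h : Finset N → ℝ)
    (S : Finset N) : ℝ :=
  sInf {x : ℝ | ∃ X : Finset N, X ⊆ S ∧ x = h X + h (S \ X)}

/-- Monotonicity refinement: `h''(S) := min over T ⊇ S of h'(T)`. -/
noncomputable def refineMono {N : Type*} [DecidableEq N] (h : Finset N → ℝ)
    (S : Finset N) : ℝ :=
  sInf {x : ℝ | ∃ T : Finset N, S ⊆ T ∧ x = refineSub h T}

theorem SubadditiveSF.le_refineSub {N : Type*} [DecidableEq N] {g h : Finset N → ℝ}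
    (hg : SubadditiveSF g) (hgh : ∀ S, g S ≤ h S) (S : Finset N) : g S ≤ refineSub h S := by
  refine le_csInf ⟨_, ∅, empty_subset S, rfl⟩ ?_
  rintro _ ⟨X, hX, rfl⟩
  calc g S = g (X ∪ S \ X) := by rw [union_sdiff_of_subset hX]
    _ ≤ g X + g (S \ X) := hg _ _ disjoint_sdiff
    _ ≤ h X + h (S \ X) := add_le_add (hgh _) (hgh _)

theorem MonotoneStep.monotoneSF {N : Type*} [DecidableEq N] {g : Finset N → ℝ}
    (hg : MonotoneStep g) : MonotoneSF g := by
  intro S T hST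
  have key : ∀ U : Finset N, g S ≤ g (U ∪ S) := by
    intro U
    induction U using Finset.induction_on with
    | empty => simp
    | insert i U _ ih =>
      rw [insert_union]
      by_cases hi : i ∈ U ∪ S
      · rwa [insert_eq_of_mem hi]
      · exact ih.trans (hg _ _ hi)
  simpa [union_eq_left.mpr hST] using key T

theorem MonotoneSF.le_refineMono {N : Type*} [DecidableEq N] {g h : Finset N → ℝ}
    (hg : MonotoneSF g) (hgh : ∀ S, g S ≤ refineSub h S) (S : Finset N) :
    g S ≤ refineMono h S := by
  refine le_csInf ⟨_, S, Subset.rfl, rfl⟩ ?_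
  rintro _ ⟨T, hT, rfl⟩
  exact (hg _ _ hT).trans (hgh T)

/-- the refinement steps of the iterative SAM-upper-bound algorithm
preserve the upper-bound property with respect to all SAM extensions of `(f, K)`. -/
theorem refinements_preserve_upper_bound {N : Type*} [Fintype N] [DecidableEq N]
    (f h : Finset N → ℝ) (K : Set (Finset N))
    (hK0 : K0 N ⊆ K) (hf0 : f ∅ = 0)
    (hub : ∀ g : Finset N → ℝ, SubadditiveSF g → MonotoneStep g →
      (∀ S ∈ K, g S = f S) → ∀ S : Finset N, g S ≤ h S) :
    (∀ g : Finset N → ℝ, SubadditiveSF g → MonotoneStep g →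
      (∀ S ∈ K, g S = f S) → ∀ S : Finset N, g S ≤ refineSub h S) ∧
    (∀ g : Finset N → ℝ, SubadditiveSF g → MonotoneStep g →
      (∀ S ∈ K, g S = f S) → ∀ S : Finset N, g S ≤ refineMono h S) := by
  have hsub : ∀ g : Finset N → ℝ, SubadditiveSF g → MonotoneStep g →
      (∀ S ∈ K, g S = f S) → ∀ S : Finset N, g S ≤ refineSub h S :=
    fun g hs hm hK => hs.le_refineSub (hub g hs hm hK)
  exact ⟨hsub, fun g hs hm hK => hm.monotoneSF.le_refineMono (hsub g hs hm hK)⟩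
end

section
/- Let N be a finite ground set, 𝒦₀ ⊆ 𝒦 ⊆ 2^N, and let (f, 𝒦) be an incomplete set function with f(∅) = 0 and f(T) ≥ 0 for all T ∈ 𝒦. Then every XOS extension g of (f, 𝒦) satisfies g(S) ≤ f̄ˣᵒˢ_𝒦(S) for all S ⊆ N, where f̄ˣᵒˢ_𝒦(S) is the infimum of ∑ᵢ αᵢ f(Tᵢ) over all fractional covers {(αᵢ, Tᵢ)}ᵢ of S with every Tᵢ ∈ 𝒦. -/
open Finset

/-- An XOS set function is fractionally subadditive. -/
theorem IsXOS.fracSubadditive {N : Type*} [DecidableEq N] {g : Finset N → ℝ}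
    (hg : IsXOS g) : FracSubadditive g := by
  obtain ⟨s, a, ha, hg⟩ := hg
  rintro S k α T ⟨hα, hcov⟩
  rw [hg S]
  refine Finset.sup'_le _ _ fun m _ => ?_
  have hle (U : Finset N) : ∑ j ∈ U, a m j ≤ g U := by
    rw [hg U]
    exact Finset.le_sup' (fun i => ∑ j ∈ U, a i j) (Finset.mem_univ m)
  calc ∑ j ∈ S, a m j
      ≤ ∑ j ∈ S, (∑ i ∈ Finset.univ.filter (fun i => j ∈ T i), α i) * a m j :=
        Finset.sum_le_sum fun j hj => le_mul_of_one_le_left (ha m j) (hcov j hj)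
    _ = ∑ i, α i * ∑ j ∈ S.filter (fun j => j ∈ T i), a m j := by
        simp only [Finset.sum_filter, Finset.sum_mul, Finset.mul_sum, ite_mul, mul_ite,
          zero_mul, mul_zero]
        exact Finset.sum_comm
    _ ≤ ∑ i, α i * g (T i) := by
        refine Finset.sum_le_sum fun i _ => mul_le_mul_of_nonneg_left ?_ (hα i).le
        refine le_trans (Finset.sum_le_sum_of_subset_of_nonneg ?_ fun j _ _ => ha m j) (hle (T i))
        exact fun j hj => (Finset.mem_filter.mp hj).2

/-- every XOS extension of `(f, K)` is bounded above by the XOS upper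
completion. -/
theorem xosUpper_bounds_extensions {N : Type*} [Fintype N] [DecidableEq N]
    (f : Finset N → ℝ) (K : Set (Finset N))
    (hK0 : K0 N ⊆ K) (hf0 : f ∅ = 0) (hnn : ∀ T ∈ K, 0 ≤ f T)
    (g : Finset N → ℝ) (hg : IsXOS g) (hagree : ∀ S ∈ K, g S = f S) :
    ∀ S : Finset N, g S ≤ xosUpper f K S := by
  intro S
  refine le_csInf ?_ ?_
  · refine ⟨_, 1, fun _ => 1, fun _ => Finset.univ, ⟨fun _ => one_pos, ?_⟩, ?_, rfl⟩
    · simp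
    · exact fun _ => hK0 (Or.inl (Or.inr rfl))
  · rintro x ⟨k, α, T, hcov, hT, rfl⟩
    refine (hg.fracSubadditive S k α T hcov).trans_eq ?_
    exact Finset.sum_congr rfl fun i _ => by rw [hagree _ (hT i)]
end

section
/- Let N be a finite ground set, 𝒦₀ ⊆ 𝒦 ⊆ 2^N, and f : 𝒦 → ℝ with f(∅) = 0 and f(T) ≥ 0 for all T ∈ 𝒦. Then the XOS upper completion f̄ˣᵒˢ_𝒦 is itself fractionally subadditive: for every S ⊆ N and every fractional cover {(αᵢ, Sᵢ)}ᵢ of S (with arbitrary Sᵢ ⊆ N) one has f̄ˣᵒˢ_𝒦(S) ≤ ∑ᵢ αᵢ f̄ˣᵒˢ_𝒦(Sᵢ). -/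
open Finset

/-- The costs of the fractional covers of `S` by sets of `K` are bounded below by `0`. -/
theorem bddBelow_fracCover_cost {N : Type*} [DecidableEq N] {f : Finset N → ℝ}
    {K : Set (Finset N)} (hnn : ∀ T ∈ K, 0 ≤ f T) (S : Finset N) :
    BddBelow {x : ℝ | ∃ (k : ℕ) (α : Fin k → ℝ) (T : Fin k → Finset N),
      IsFracCover S k α T ∧ (∀ i, T i ∈ K) ∧ x = ∑ i, α i * f (T i)} := by
  refine ⟨0, ?_⟩
  rintro x ⟨k, α, T, hc, hT, rfl⟩
  exact Finset.sum_nonneg fun i _ => mul_nonneg (hc.1 i).le (hnn _ (hT i))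

/-- The XOS upper completion is at most the cost of any fractional cover, indexed by an
arbitrary finite type. -/
theorem xosUpper_le_sum {N ι : Type*} [DecidableEq N] [Fintype ι] {f : Finset N → ℝ}
    {K : Set (Finset N)} (hnn : ∀ T ∈ K, 0 ≤ f T) {S : Finset N} {α : ι → ℝ}
    {T : ι → Finset N} (hα : ∀ i, 0 < α i)
    (hcov : ∀ j ∈ S, 1 ≤ ∑ i, if j ∈ T i then α i else 0) (hT : ∀ i, T i ∈ K) :
    xosUpper f K S ≤ ∑ i, α i * f (T i) := by
  let e := (Fintype.equivFin ι).symm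
  refine csInf_le (bddBelow_fracCover_cost hnn S)
    ⟨_, α ∘ e, T ∘ e, ⟨fun i => hα _, fun j hj => ?_⟩, fun i => hT _, ?_⟩
  · rw [Finset.sum_filter]
    exact (hcov j hj).trans_eq (e.sum_comp fun i => if j ∈ T i then α i else 0).symm
  · exact (e.sum_comp fun i => α i * f (T i)).symm

/-- Some fractional cover of `S` by sets of `K` costs less than `xosUpper f K S + ε`. -/
theorem exists_fracCover_lt {N : Type*} [DecidableEq N] [Fintype N] (f : Finset N → ℝ)
    {K : Set (Finset N)} (huniv : Finset.univ ∈ K) (S : Finset N) {ε : ℝ} (hε : 0 < ε) :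
    ∃ (k : ℕ) (α : Fin k → ℝ) (T : Fin k → Finset N),
      IsFracCover S k α T ∧ (∀ i, T i ∈ K) ∧ ∑ i, α i * f (T i) < xosUpper f K S + ε := by
  have hne : {x : ℝ | ∃ (k : ℕ) (α : Fin k → ℝ) (T : Fin k → Finset N),
      IsFracCover S k α T ∧ (∀ i, T i ∈ K) ∧ x = ∑ i, α i * f (T i)}.Nonempty :=
    ⟨_, 1, fun _ => 1, fun _ => Finset.univ, ⟨fun _ => one_pos, fun j _ => by simp⟩,
      fun _ => huniv, rfl⟩
  obtain ⟨_, ⟨k, α, T, hc, hT, rfl⟩, hlt⟩ := Real.lt_sInf_add_pos hne hε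
  exact ⟨k, α, T, hc, hT, hlt⟩

/-- the XOS upper completion is itself fractionally subadditive. -/
theorem xosUpper_fracSubadditive {N : Type*} [Fintype N] [DecidableEq N]
    (f : Finset N → ℝ) (K : Set (Finset N))
    (hK0 : K0 N ⊆ K) (hf0 : f ∅ = 0) (hnn : ∀ T ∈ K, 0 ≤ f T) :
    ∀ (S : Finset N) (k : ℕ) (α : Fin k → ℝ) (Ss : Fin k → Finset N),
      IsFracCover S k α Ss →
      xosUpper f K S ≤ ∑ i, α i * xosUpper f K (Ss i) := by
  intro S k α Ss hS
  have huniv : (Finset.univ : Finset N) ∈ K := hK0 (Or.inl (Or.inr rfl))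
  have hA : 0 ≤ ∑ i, α i := Finset.sum_nonneg fun i _ => (hS.1 i).le
  refine le_of_forall_pos_le_add fun δ hδ => ?_
  have hε : 0 < δ / (∑ i, α i + 1) := by positivity
  choose m β T hc hT hlt using fun i => exists_fracCover_lt f huniv (Ss i) hε
  have hle : xosUpper f K S ≤
      ∑ p : (i : Fin k) × Fin (m i), (α p.1 * β p.1 p.2) * f (T p.1 p.2) := by
    refine xosUpper_le_sum hnn (fun p => mul_pos (hS.1 _) ((hc _).1 _)) (fun j hj => ?_)
      fun p => hT _ _
    refine (hS.2 j hj).trans ?_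
    rw [Finset.sum_filter, Fintype.sum_sigma]
    refine Finset.sum_le_sum fun i _ => ?_
    simp only [← mul_ite_zero, ← Finset.mul_sum, ← Finset.sum_filter]
    split_ifs with hji
    · exact le_mul_of_one_le_right (hS.1 i).le ((hc i).2 j hji)
    · exact mul_nonneg (hS.1 i).le (Finset.sum_nonneg fun l _ => ((hc i).1 l).le)
  calc xosUpper f K S
      ≤ ∑ i, α i * ∑ l, β i l * f (T i l) := by
        simpa only [Fintype.sum_sigma, mul_assoc, ← Finset.mul_sum] using hle
    _ ≤ ∑ i, α i * (xosUpper f K (Ss i) + δ / (∑ i, α i + 1)) :=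
        Finset.sum_le_sum fun i _ => mul_le_mul_of_nonneg_left (hlt i).le (hS.1 i).le
    _ = ∑ i, α i * xosUpper f K (Ss i) + (∑ i, α i) * (δ / (∑ i, α i + 1)) := by
        simp only [mul_add, Finset.sum_add_distrib, Finset.sum_mul]
    _ ≤ ∑ i, α i * xosUpper f K (Ss i) + δ := by
        gcongr
        rw [mul_div_assoc', div_le_iff₀ (by positivity)]
        nlinarith
end

section
/- For every real M > 0 there exist a ground set N with |N| = 4, an XOS set function f : 2^N → ℝ with f(∅) = 0, a family 𝒦 with 𝒦₀ ⊆ 𝒦 ⊆ 2^N, and a subset S ∉ 𝒦 such that f̄ˢᵃᵐ_𝒦(S) − f̄ˣᵒˢ_𝒦(S) ≥ M. That is, the gap between the SAM upper completion and the XOS upper completion of an XOS incomplete set function can be arbitrarily large. -/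
open Finset

/-- The maximum over `S` of the weights `2M` (on `0, 1, 2`) and `4M` (on `3`), as a maximum of
additive set functions supported on single elements. -/
noncomputable def weightMax (M : ℝ) (S : Finset (Fin 4)) : ℝ :=
  Finset.univ.sup' Finset.univ_nonempty fun i : Fin (3 + 1) =>
    ∑ j ∈ S, if j = i then (if i = 3 then 4 * M else 2 * M) else 0

lemma le_weightMax {M : ℝ} {S : Finset (Fin 4)} {i : Fin 4} (hi : i ∈ S) :
    (if i = 3 then 4 * M else 2 * M) ≤ weightMax M S := by
  have h := Finset.le_sup' (fun i : Fin (3 + 1) =>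
    ∑ j ∈ S, if j = i then (if i = 3 then 4 * M else 2 * M) else 0) (Finset.mem_univ i)
  rw [Finset.sum_ite_eq', if_pos hi] at h
  exact h

lemma weightMax_le {M c : ℝ} {S : Finset (Fin 4)} (hc : 0 ≤ c)
    (h : ∀ i ∈ S, (if i = 3 then 4 * M else 2 * M) ≤ c) : weightMax M S ≤ c := by
  refine Finset.sup'_le _ _ fun i _ => ?_
  rw [Finset.sum_ite_eq']
  by_cases hi : i ∈ S
  · rw [if_pos hi]
    exact h i hi
  · rwa [if_neg hi]

lemma weightMax_nonneg {M : ℝ} (hM : 0 ≤ M) (S : Finset (Fin 4)) : 0 ≤ weightMax M S := by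
  refine le_trans (Finset.sum_nonneg fun j _ => ?_) (Finset.le_sup' (fun i : Fin (3 + 1) =>
    ∑ j ∈ S, if j = i then (if i = 3 then 4 * M else 2 * M) else 0) (Finset.mem_univ 0))
  split_ifs <;> positivity

lemma weightMax_empty (M : ℝ) : weightMax M ∅ = 0 := by
  simp [weightMax]

lemma isXOS_weightMax {M : ℝ} (hM : 0 ≤ M) : IsXOS (weightMax M) := by
  refine ⟨3, fun i j => if j = i then (if i = 3 then 4 * M else 2 * M) else 0,
    fun i j => ?_, fun S => rfl⟩
  dsimp only
  split_ifs <;> positivity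

lemma le_samUpper_weightMax {M : ℝ} (hM : 0 ≤ M) :
    4 * M ≤ samUpper (weightMax M) {({0, 1, 2} : Finset (Fin 4))}ᶜ {0, 1, 2} := by
  refine le_csInf ⟨_, 0, fun _ => Finset.univ, fun _ => by simp; decide, by simp, rfl⟩ ?_
  rintro x ⟨k, Ss, hK, hcov, rfl⟩
  have hmem : ∀ j ∈ ({0, 1, 2} : Finset (Fin 4)), ∃ i, j ∈ Ss i := fun j hj => by
    simpa [Finset.mem_sup] using hcov hj
  have hnn : ∀ i ∈ Finset.univ, 0 ≤ weightMax M (Ss i) := fun i _ => weightMax_nonneg hM _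
  have hlow : ∀ {j : Fin 4} {T : Finset (Fin 4)}, j ∈ T → 2 * M ≤ weightMax M T := by
    intro j T hj
    refine le_trans ?_ (le_weightMax hj)
    split_ifs <;> linarith
  obtain ⟨i, hi⟩ := hmem 0 (by simp)
  by_cases h3 : (3 : Fin 4) ∈ Ss i
  · have h := le_weightMax (M := M) h3
    rw [if_pos rfl] at h
    exact h.trans (Finset.single_le_sum hnn (Finset.mem_univ i))
  · obtain ⟨j, hj, hji⟩ : ∃ j ∈ ({0, 1, 2} : Finset (Fin 4)), j ∉ Ss i := by
      by_contra! hsub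
      refine hK i (Finset.Subset.antisymm (fun j hj => ?_) hsub)
      fin_cases j <;> simp_all
    obtain ⟨i', hi'⟩ := hmem j hj
    have hne : i ≠ i' := by
      rintro rfl
      exact hji hi'
    calc 4 * M ≤ weightMax M (Ss i) + weightMax M (Ss i') := by linarith [hlow hi, hlow hi']
      _ = ∑ l ∈ {i, i'}, weightMax M (Ss l) := by rw [Finset.sum_pair hne]
      _ ≤ ∑ l, weightMax M (Ss l) :=
        Finset.sum_le_sum_of_subset_of_nonneg (Finset.subset_univ _) fun l hl _ => hnn l hl

lemma xosUpper_weightMax_le {M : ℝ} (hM : 0 ≤ M) :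
    xosUpper (weightMax M) {({0, 1, 2} : Finset (Fin 4))}ᶜ {0, 1, 2} ≤ 3 * M := by
  have hbdd : BddBelow {x : ℝ | ∃ (k : ℕ) (α : Fin k → ℝ) (T : Fin k → Finset (Fin 4)),
      IsFracCover {0, 1, 2} k α T ∧ (∀ i, T i ∈ ({({0, 1, 2} : Finset (Fin 4))}ᶜ : Set _)) ∧
        x = ∑ i, α i * weightMax M (T i)} := by
    refine ⟨0, ?_⟩
    rintro x ⟨k, α, T, hα, -, rfl⟩
    exact Finset.sum_nonneg fun i _ => mul_nonneg (hα.1 i).le (weightMax_nonneg hM _)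
  refine (csInf_le hbdd ⟨3, fun _ => 1 / 2, ![{0, 1}, {1, 2}, {0, 2}], ⟨fun _ => by norm_num, ?_⟩,
    ?_, rfl⟩).trans ?_
  · intro j hj
    rw [Finset.sum_filter, Fin.sum_univ_three]
    fin_cases j <;> simp at hj ⊢ <;> norm_num
  · intro i
    rw [Set.mem_compl_iff, Set.mem_singleton_iff]
    revert i
    decide
  · have hpair : ∀ {T : Finset (Fin 4)}, (3 : Fin 4) ∉ T → weightMax M T ≤ 2 * M :=
      fun {T} hT => weightMax_le (by linarith) fun i hi => by
        rw [if_neg (ne_of_mem_of_not_mem hi hT)]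
    have h01 := hpair (T := {0, 1}) (by decide)
    have h12 := hpair (T := {1, 2}) (by decide)
    have h02 := hpair (T := {0, 2}) (by decide)
    simp only [Fin.sum_univ_three, Matrix.cons_val]
    linarith

/-- on a ground set of four elements, the gap between the SAM upper
completion and the XOS upper completion of an XOS incomplete set function can be
arbitrarily large. -/
theorem sam_xos_upper_gap_unbounded :
    ∀ M : ℝ, 0 < M →
      ∃ (f : Finset (Fin 4) → ℝ) (K : Set (Finset (Fin 4))) (S : Finset (Fin 4)),
        IsXOS f ∧ f ∅ = 0 ∧ K0 (Fin 4) ⊆ K ∧ S ∉ K ∧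
        M ≤ samUpper f K S - xosUpper f K S := by
  intro M hM
  refine ⟨weightMax M, {({0, 1, 2} : Finset (Fin 4))}ᶜ, {0, 1, 2}, isXOS_weightMax hM.le,
    weightMax_empty M, ?_, by simp, ?_⟩
  · rintro T ((rfl | rfl) | ⟨i, rfl⟩) <;> rw [Set.mem_compl_iff, Set.mem_singleton_iff]
    · decide
    · decide
    · revert i
      decide
  · linarith [le_samUpper_weightMax hM.le, xosUpper_weightMax_le hM.le]
end

section
/- Let N be a finite ground set, f : 2^N → ℝ a set function with f(∅) = 0, 𝒦₀ ⊆ 𝒦 ⊆ 2^N ∖ {S}, and T ⊆ N such that S ∩ T ≠ ∅, S ⊄ T and T ⊄ S. Then both completions at T are unchanged by revealing S: f̄_𝒦(T) = f̄_{𝒦∪{S}}(T) and f̲_𝒦(T) = f̲_{𝒦∪{S}}(T). -/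
open Finset

/-- Revealing `S` does not change the upper completion at sets that do not contain `S`. -/
theorem upperC_union_singleton_of_not_subset {N : Type*} [DecidableEq N]
    (f : Finset N → ℝ) (K : Set (Finset N)) {S X : Finset N} (h : ¬ S ⊆ X) :
    upperC f (K ∪ {S}) X = upperC f K X := by
  unfold upperC
  congr 2
  ext x
  refine exists_congr fun P => ⟨?_, ?_⟩
  · rintro ⟨hK, hne, hdisj, hsup, hx⟩
    refine ⟨fun A hA => (hK A hA).resolve_right ?_, hne, hdisj, hsup, hx⟩
    rintro rfl
    exact h (hsup ▸ Finset.le_sup (f := id) hA)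
  · rintro ⟨hK, hrest⟩
    exact ⟨fun A hA => Or.inl (hK A hA), hrest⟩

/-- if `S` and `T` properly overlap (nonempty intersection, neither
contains the other), both completions at `T` are unchanged by revealing `S`. -/
theorem completions_unchanged_crossing {N : Type*} [Fintype N] [DecidableEq N]
    (f : Finset N → ℝ) (hf0 : f ∅ = 0)
    (K : Set (Finset N)) (S : Finset N) (hK0 : K0 N ⊆ K) (hS : S ∉ K)
    (T : Finset N) (hint : (S ∩ T).Nonempty) (hST : ¬ S ⊆ T) (hTS : ¬ T ⊆ S) :
    upperC f K T = upperC f (K ∪ {S}) T ∧ lowerC f K T = lowerC f (K ∪ {S}) T := by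
  refine ⟨(upperC_union_singleton_of_not_subset f K hST).symm, ?_⟩
  have hdiff (X : Finset N) : ¬ S ⊆ X \ T := fun h => by
    obtain ⟨i, hi⟩ := hint
    rw [Finset.mem_inter] at hi
    exact (Finset.mem_sdiff.1 (h hi.1)).2 hi.2
  unfold lowerC
  congr 1
  ext x
  refine exists_congr fun X => ?_
  rw [upperC_union_singleton_of_not_subset f K (hdiff X)]
  refine ⟨fun ⟨hX, hrest⟩ => ⟨Or.inl hX, hrest⟩, fun ⟨hX, hTX, hx⟩ => ⟨?_, hTX, hx⟩⟩
  refine hX.resolve_right ?_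
  rintro rfl
  exact hTS hTX
end
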